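/- The combinatorial constant K_s = \sum_{k=1}^{s} \binom{s+1}{k} K(s+1-k,s) \cdot K(k,s) satisfies the closed form K_s = 2^{2s+1} \cdot s^2 \cdot (3s)! / (2s+1)!. -/

import Mathlib

open Finset

/-- The constant `K(i,s)` from Ore's bound on intermediate derivatives:
`K(i,s) = 2^i · s²(s²-1²)⋯(s²-(i-1)²) / (1·3·5⋯(2i-1))`. -/
noncomputable def oreK (i s : ℕ) : ℝ :=
  2 ^ i * (∏ j ∈ Finset.range i, ((s : ℝ) ^ 2 - (j : ℝ) ^ 2)) /
    (∏ j ∈ Finset.range i, ((2 * j : ℝ) + 1))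

open Polynomial in
lemma oreK_eq (i s : ℕ) :
    oreK i s = 2 ^ i * (derivative^[i] (Chebyshev.T ℝ (s : ℤ))).eval 1 := by
  rw [Chebyshev.iterate_derivative_T_eval_one_eq_div, oreK]
  push_cast
  ring

open Polynomial in
lemma oreK_conv (n s : ℕ) :
    2 * ∑ k ∈ Finset.range (n + 2), ((n + 1).choose k : ℝ) * oreK (n + 1 - k) s * oreK k s
      = oreK (n + 1) (2 * s) := by
  have h := Chebyshev.T_mul_T ℝ (s : ℤ) (s : ℤ)
  rw [sub_self, Chebyshev.T_zero, mul_assoc, ← two_mul] at h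
  have h2 := congrArg (fun p => (derivative^[n + 1] p).eval 1) h
  have e : (2 : ℝ[X]) * (Chebyshev.T ℝ (s : ℤ) * Chebyshev.T ℝ (s : ℤ))
      = (2 : ℝ) • (Chebyshev.T ℝ (s : ℤ) * Chebyshev.T ℝ (s : ℤ)) := by
    rw [smul_eq_C_mul]; rfl
  have e1 : derivative^[n + 1] (1 : ℝ[X]) = 0 := by
    simp [Function.iterate_succ_apply]
  simp only [e, iterate_derivative_smul, iterate_derivative_mul, iterate_map_add, eval_add, eval_zero, e1,
    add_zero, eval_smul, eval_finsetSum, smul_eq_mul, nsmul_eq_mul, eval_mul,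
    eval_natCast] at h2
  rw [oreK_eq]
  push_cast
  rw [← h2, Finset.mul_sum, Finset.mul_sum, Finset.mul_sum]
  refine Finset.sum_congr rfl fun k hk => ?_
  have hk' : k ≤ n + 1 := by have := Finset.mem_range.1 hk; omega
  rw [oreK_eq, oreK_eq]
  have hp : (2 : ℝ) ^ (n + 1) = 2 ^ (n + 1 - k) * 2 ^ k := by
    rw [← pow_add, Nat.sub_add_cancel hk']
  rw [hp]
  ring

lemma prod_num (i r : ℕ) :
    (∏ j ∈ Finset.range (i + 1), (((i + 1 + r : ℕ) : ℝ) ^ 2 - (j : ℝ) ^ 2)) * (r.factorial : ℝ)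
      = ((i + 1 + r : ℕ) : ℝ) * ((i + 1 + r + i).factorial : ℝ) := by
  induction i generalizing r with
  | zero =>
    simp [show 0 + 1 + r = r + 1 by omega, Nat.factorial_succ]
    ring
  | succ i ih =>
    have h := ih (r + 1)
    rw [show i + 1 + (r + 1) = i + 1 + 1 + r by omega, Nat.factorial_succ] at h
    rw [Finset.prod_range_succ,
      show i + 1 + 1 + r + (i + 1) = (i + 1 + 1 + r + i) + 1 by omega, Nat.factorial_succ]
    push_cast at h ⊢
    linear_combination ((i : ℝ) + 1 + 1 + r + i + 1) * h

lemma prod_den (i : ℕ) :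
    (∏ j ∈ Finset.range i, ((2 * j : ℝ) + 1)) * (2 ^ i * (i.factorial : ℝ))
      = ((2 * i).factorial : ℝ) := by
  induction i with
  | zero => simp
  | succ i ih =>
    rw [Finset.prod_range_succ, show 2 * (i + 1) = 2 * i + 1 + 1 by ring, Nat.factorial_succ,
      Nat.factorial_succ, Nat.factorial_succ]
    push_cast
    rw [← ih]
    ring

theorem stmt_0 (s : ℕ) (hs : 1 ≤ s) :
    ∑ k ∈ Finset.Icc 1 s, ((s + 1).choose k : ℝ) * oreK (s + 1 - k) s * oreK k s =
      2 ^ (2 * s + 1) * (s : ℝ) ^ 2 * (Nat.factorial (3 * s)) /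
        (Nat.factorial (2 * s + 1)) := by
  have hz : oreK (s + 1) s = 0 := by
    simp [oreK, Finset.prod_range_succ]
  have hc := oreK_conv s s
  rw [Finset.sum_range_succ, Finset.sum_range_succ', hz] at hc
  have hI : ∑ k ∈ Finset.Icc 1 s, ((s + 1).choose k : ℝ) * oreK (s + 1 - k) s * oreK k s
      = ∑ k ∈ Finset.range s,
        ((s + 1).choose (k + 1) : ℝ) * oreK (s + 1 - (k + 1)) s * oreK (k + 1) s := by
    rw [← Finset.Ico_add_one_right_eq_Icc, Finset.sum_Ico_eq_sum_range]
    refine Finset.sum_congr (by simp) fun k _ => ?_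
    rw [add_comm 1 k]
  rw [← hI] at hc
  simp only [Nat.sub_zero, hz, mul_zero, zero_mul, add_zero] at hc
  obtain ⟨t, rfl⟩ : ∃ t, s = t + 1 := ⟨s - 1, by omega⟩
  have hn := prod_num (t + 1) t
  have hd := prod_den (t + 1 + 1)
  rw [show t + 1 + 1 + t = 2 * (t + 1) by ring,
    show 2 * (t + 1) + (t + 1) = 3 * (t + 1) by ring] at hn
  rw [show 2 * (t + 1 + 1) = 2 * (t + 1) + 1 + 1 by ring, Nat.factorial_succ (2 * (t + 1) + 1),
    Nat.factorial_succ (t + 1), Nat.factorial_succ t] at hd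
  rw [oreK] at hc
  set S := ∑ k ∈ Finset.Icc 1 (t + 1),
    ((t + 1 + 1).choose k : ℝ) * oreK (t + 1 + 1 - k) (t + 1) * oreK k (t + 1)
  set D := ∏ j ∈ Finset.range (t + 1 + 1), ((2 * j : ℝ) + 1) with hD
  set N := ∏ j ∈ Finset.range (t + 1 + 1), (((2 * (t + 1) : ℕ) : ℝ) ^ 2 - (j : ℝ) ^ 2)
  have hD0 : D ≠ 0 := by rw [hD]; exact Finset.prod_ne_zero_iff.2 fun j _ => by positivity
  have hF : ((2 * (t + 1) + 1).factorial : ℝ) ≠ 0 := by positivity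
  have hf : (t.factorial : ℝ) ≠ 0 := by positivity
  rw [eq_div_iff hD0] at hc
  rw [eq_div_iff hF]
  set F := ((2 * (t + 1) + 1).factorial : ℝ) with hFd
  set f := (t.factorial : ℝ)
  set G := ((3 * (t + 1)).factorial : ℝ)
  push_cast at hd hn ⊢
  rw [← hFd] at hd
  have ht : (2 * ((t : ℝ) + 1) + 1 + 1) ≠ 0 := by positivity
  have hF' : F = D * (2 ^ (t + 1) * (t + 1) * f) := by
    apply mul_left_cancel₀ ht
    rw [← hd]; ring
  rw [hF']
  have e : S * (D * (2 ^ (t + 1) * (t + 1) * f)) * 2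
      = (2 * S * D) * (2 ^ (t + 1) * (t + 1) * f) := by ring
  apply mul_right_cancel₀ (two_ne_zero (α := ℝ))
  rw [e, hc]
  linear_combination (2 ^ (t + 1 + 1) * 2 ^ (t + 1) * ((t : ℝ) + 1)) * hn
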